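/- arXiv:2211.09639 — 2 statements merged into one kernel-verified Lean document; each statement's English description precedes it below -/
import Mathlib

section
/- Brunn–Minkowski inequality: for nonempty compact sets A, B ⊆ ℝ^n, μ(A + B)^{1/n} ≥ μ(A)^{1/n} + μ(B)^{1/n}, where A + B = {a + b : a ∈ A, b ∈ B} is the Minkowski sum and μ is Lebesgue measure. -/
open MeasureTheory
open scoped ENNReal Pointwise

namespace PrekopaLeindler

/-- The one-dimensional Brunn–Minkowski inequality for compact sets. -/
theorem volume_add_le_of_isCompact {K L : Set ℝ} (hK : IsCompact K) (hL : IsCompact L)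
    (hK0 : K.Nonempty) (hL0 : L.Nonempty) : volume K + volume L ≤ volume (K + L) := by
  obtain ⟨b, hbK, hb⟩ := hK.exists_isGreatest hK0
  obtain ⟨a, haL, ha⟩ := hL.exists_isLeast hL0
  have hsub : (a +ᵥ K) ∪ (b +ᵥ L) ⊆ K + L := by
    rintro x (hx | hx)
    · obtain ⟨k, hk, rfl⟩ := hx
      exact ⟨k, hk, a, haL, add_comm _ _⟩
    · obtain ⟨l, hl, rfl⟩ := hx
      exact ⟨b, hbK, l, hl, rfl⟩
  have hdisj : AEDisjoint volume (a +ᵥ K) (b +ᵥ L) := by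
    refine measure_mono_null (t := {a + b}) ?_ (by simp)
    rintro x ⟨⟨k, hk, rfl⟩, ⟨l, hl, hkl⟩⟩
    have h1 := hb hk
    have h2 := ha hl
    simp only [vadd_eq_add, Set.mem_singleton_iff] at hkl ⊢
    linarith
  have hmeas : NullMeasurableSet (b +ᵥ L) volume :=
    (hL.vadd b).measurableSet.nullMeasurableSet
  calc volume K + volume L = volume ((a +ᵥ K) ∪ (b +ᵥ L)) := by
        rw [measure_union₀ hmeas hdisj, measure_vadd, measure_vadd]
    _ ≤ _ := measure_mono hsub

/-- The one-dimensional Brunn–Minkowski inequality for measurable sets. -/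
theorem volume_add_le {A B : Set ℝ} (hA : MeasurableSet A) (hB : MeasurableSet B)
    (hA0 : A.Nonempty) (hB0 : B.Nonempty) : volume A + volume B ≤ volume (A + B) := by
  obtain ⟨a, ha⟩ := hA0
  obtain ⟨b, hb⟩ := hB0
  rw [hA.measure_eq_iSup_isCompact, hB.measure_eq_iSup_isCompact]
  simp only [iSup_and', iSup_subtype']
  have : Nonempty {K : Set ℝ // K ⊆ A ∧ IsCompact K} := ⟨⟨∅, by simp⟩⟩
  have : Nonempty {K : Set ℝ // K ⊆ B ∧ IsCompact K} := ⟨⟨∅, by simp⟩⟩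
  refine ENNReal.iSup_add_iSup_le ?_
  rintro ⟨K, hKA, hK⟩ ⟨L, hLB, hL⟩
  calc volume K + volume L ≤ volume (insert a K) + volume (insert b L) := by
        gcongr <;> exact Set.subset_insert _ _
    _ ≤ volume (insert a K + insert b L) :=
        volume_add_le_of_isCompact (hK.insert a) (hL.insert b) (by simp) (by simp)
    _ ≤ volume (A + B) := by
        gcongr
        · exact Set.insert_subset ha hKA
        · exact Set.insert_subset hb hLB

theorem ennreal_geom_mean_le_arith_mean {p q : ℝ} (hp : 0 < p) (hq : 0 < q) (hpq : p + q = 1)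
    (a b : ℝ≥0∞) :
    a ^ p * b ^ q ≤ ENNReal.ofReal p * a + ENNReal.ofReal q * b := by
  induction a with
  | top => simp [ENNReal.mul_top, hp]
  | coe a =>
    induction b with
    | top => simp [ENNReal.mul_top, hq]
    | coe b =>
      have h := NNReal.geom_mean_le_arith_mean2_weighted p.toNNReal q.toNNReal a b
        (by rw [← Real.toNNReal_add hp.le hq.le, hpq, Real.toNNReal_one])
      rw [Real.coe_toNNReal _ hp.le, Real.coe_toNNReal _ hq.le] at h
      rw [← ENNReal.coe_rpow_of_nonneg _ hp.le, ← ENNReal.coe_rpow_of_nonneg _ hq.le]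
      simp only [ENNReal.ofReal]
      exact_mod_cast h

theorem lintegral_eq_lintegral_measure_ofReal_lt {α : Type*} [MeasurableSpace α] (μ : Measure α)
    {f : α → ℝ≥0∞} (hf : Measurable f) (hf' : ∀ x, f x ≠ ∞) :
    ∫⁻ x, f x ∂μ = ∫⁻ t in Set.Ioi (0 : ℝ), μ {x | ENNReal.ofReal t < f x} := by
  have h := lintegral_eq_lintegral_meas_lt μ (f := fun x => (f x).toReal)
    (Filter.Eventually.of_forall fun x => ENNReal.toReal_nonneg) hf.ennreal_toReal.aemeasurable
  simp only [ENNReal.ofReal_toReal (hf' _)] at h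
  rw [h]
  refine setLIntegral_congr_fun measurableSet_Ioi fun t ht => ?_
  simp only [ENNReal.ofReal_lt_iff_lt_toReal (le_of_lt ht) (hf' _)]

theorem lintegral_eq_iSup_lintegral_min {α : Type*} [MeasurableSpace α] (μ : Measure α)
    {f : α → ℝ≥0∞} (hf : Measurable f) :
    ∫⁻ x, f x ∂μ = ⨆ k : ℕ, ∫⁻ x, min (f x) k ∂μ := by
  rw [← lintegral_iSup (fun k => hf.min measurable_const)]
  · congr 1
    ext x
    rw [← inf_iSup_eq, ENNReal.iSup_natCast, inf_top_eq]
  · intro k l hkl x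
    dsimp only
    gcongr

/-- The Prékopa–Leindler inequality, as a property of a measure. -/
def Holds {E : Type*} [AddCommGroup E] [Module ℝ E] [MeasurableSpace E] (μ : Measure E) : Prop :=
  ∀ ⦃p q : ℝ⦄, 0 < p → 0 < q → p + q = 1 → ∀ ⦃f g h : E → ℝ≥0∞⦄,
    Measurable f → Measurable g → Measurable h →
    (∀ x y, f x ^ p * g y ^ q ≤ h (p • x + q • y)) →
    (∫⁻ x, f x ∂μ) ^ p * (∫⁻ x, g x ∂μ) ^ q ≤ ∫⁻ x, h x ∂μ

/-- The arithmetic form of the Prékopa–Leindler inequality on the line, for functions of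
supremum one. -/
theorem real_of_iSup_eq_one {p q : ℝ} (hp : 0 < p) (hq : 0 < q) (hpq : p + q = 1)
    {f g h : ℝ → ℝ≥0∞} (hf : Measurable f) (hg : Measurable g) (hh : Measurable h)
    (hf1 : ⨆ x, f x = 1) (hg1 : ⨆ x, g x = 1)
    (H : ∀ x y, f x ^ p * g y ^ q ≤ h (p • x + q • y)) :
    ENNReal.ofReal p * (∫⁻ x, f x) + ENNReal.ofReal q * ∫⁻ x, g x ≤ ∫⁻ x, h x := by
  have hfle x : f x ≤ 1 := hf1 ▸ le_iSup f x
  have hgle x : g x ≤ 1 := hg1 ▸ le_iSup g x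
  have anti (u : ℝ → ℝ≥0∞) :
      Measurable fun t : ℝ => volume {x | ENNReal.ofReal t < u x} := by
    refine Antitone.measurable fun s t hst => measure_mono fun x hx => ?_
    exact (ENNReal.ofReal_le_ofReal hst).trans_lt hx
  calc ENNReal.ofReal p * (∫⁻ x, f x) + ENNReal.ofReal q * ∫⁻ x, g x
      ≤ ∫⁻ x, min (h x) 1 := by
        rw [lintegral_eq_lintegral_measure_ofReal_lt volume hf
            fun x => ((hfle x).trans_lt ENNReal.one_lt_top).ne,
          lintegral_eq_lintegral_measure_ofReal_lt volume hg
            fun x => ((hgle x).trans_lt ENNReal.one_lt_top).ne,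
          lintegral_eq_lintegral_measure_ofReal_lt volume (hh.min measurable_const)
            fun x => ((min_le_right _ _).trans_lt ENNReal.one_lt_top).ne,
          ← lintegral_const_mul _ (anti f), ← lintegral_const_mul _ (anti g),
          ← lintegral_add_left ((anti f).const_mul _)]
        refine setLIntegral_mono' measurableSet_Ioi fun t (ht : 0 < t) => ?_
        rcases le_or_gt 1 t with h1 | h1
        · have h1' : 1 ≤ ENNReal.ofReal t := by simpa using h1
          have e1 : {x | ENNReal.ofReal t < f x} = ∅ :=
            Set.eq_empty_of_forall_notMem fun x hx =>
              (((hfle x).trans h1').trans_lt hx).false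
          have e2 : {x | ENNReal.ofReal t < g x} = ∅ :=
            Set.eq_empty_of_forall_notMem fun x hx =>
              (((hgle x).trans h1').trans_lt hx).false
          simp [e1, e2]
        · have h1' : ENNReal.ofReal t < 1 := by simpa using h1
          have n1 : {x | ENNReal.ofReal t < f x}.Nonempty :=
            lt_iSup_iff.1 (h1'.trans_eq hf1.symm)
          have n2 : {x | ENNReal.ofReal t < g x}.Nonempty :=
            lt_iSup_iff.1 (h1'.trans_eq hg1.symm)
          have m1 : MeasurableSet {x | ENNReal.ofReal t < f x} := hf measurableSet_Ioi
          have m2 : MeasurableSet {x | ENNReal.ofReal t < g x} := hg measurableSet_Ioi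
          have key := volume_add_le (m1.const_smul₀ p) (m2.const_smul₀ q) n1.smul_set n2.smul_set
          rw [Measure.addHaar_smul, Measure.addHaar_smul] at key
          simp only [Module.finrank_self, pow_one, abs_of_pos hp, abs_of_pos hq] at key
          refine key.trans (measure_mono ?_)
          rintro _ ⟨_, ⟨x, hx, rfl⟩, _, ⟨y, hy, rfl⟩, rfl⟩
          refine lt_min ?_ h1'
          calc ENNReal.ofReal t = ENNReal.ofReal t ^ p * ENNReal.ofReal t ^ q := by
                rw [← ENNReal.rpow_add_of_nonneg _ _ hp.le hq.le, hpq, ENNReal.rpow_one]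
            _ < f x ^ p * g y ^ q :=
                ENNReal.mul_lt_mul (ENNReal.rpow_lt_rpow hx hp) (ENNReal.rpow_lt_rpow hy hq)
            _ ≤ _ := H x y
    _ ≤ ∫⁻ x, h x := lintegral_mono fun x => min_le_left _ _

theorem real_of_iSup_ne_top {p q : ℝ} (hp : 0 < p) (hq : 0 < q) (hpq : p + q = 1)
    {f g h : ℝ → ℝ≥0∞} (hf : Measurable f) (hg : Measurable g) (hh : Measurable h)
    (hf1 : ⨆ x, f x ≠ ∞) (hg1 : ⨆ x, g x ≠ ∞)
    (H : ∀ x y, f x ^ p * g y ^ q ≤ h (p • x + q • y)) :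
    (∫⁻ x, f x) ^ p * (∫⁻ x, g x) ^ q ≤ ∫⁻ x, h x := by
  set M := ⨆ x, f x with hM
  set N := ⨆ x, g x with hN
  rcases eq_or_ne M 0 with hM0 | hM0
  · have : ∀ x, f x = 0 := fun x => le_zero_iff.1 (hM0 ▸ le_iSup f x)
    simp [this, hp]
  rcases eq_or_ne N 0 with hN0 | hN0
  · have : ∀ x, g x = 0 := fun x => le_zero_iff.1 (hN0 ▸ le_iSup g x)
    simp [this, hq]
  have hMp0 : M ^ p ≠ 0 := by simp [hM0, hf1]
  have hNq0 : N ^ q ≠ 0 := by simp [hN0, hg1]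
  have hMp : M ^ p ≠ ∞ := ENNReal.rpow_ne_top_of_nonneg hp.le hf1
  have hNq : N ^ q ≠ ∞ := ENNReal.rpow_ne_top_of_nonneg hq.le hg1
  have hinv : (M⁻¹) ^ p * (N⁻¹) ^ q = (M ^ p * N ^ q)⁻¹ := by
    rw [ENNReal.inv_rpow, ENNReal.inv_rpow, ENNReal.mul_inv (.inl hMp0) (.inl hMp)]
  have key := real_of_iSup_eq_one hp hq hpq (hf.const_mul M⁻¹) (hg.const_mul N⁻¹)
    (hh.const_mul (M ^ p * N ^ q)⁻¹)
    (by rw [← ENNReal.mul_iSup, ← hM, ENNReal.inv_mul_cancel hM0 hf1])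
    (by rw [← ENNReal.mul_iSup, ← hN, ENNReal.inv_mul_cancel hN0 hg1])
    (fun x y => by
      rw [ENNReal.mul_rpow_of_nonneg _ _ hp.le, ENNReal.mul_rpow_of_nonneg _ _ hq.le,
        mul_mul_mul_comm, hinv]
      gcongr
      exact H x y)
  have key2 := (ennreal_geom_mean_le_arith_mean hp hq hpq _ _).trans key
  rw [lintegral_const_mul _ hf, lintegral_const_mul _ hg, lintegral_const_mul _ hh,
    ENNReal.mul_rpow_of_nonneg _ _ hp.le, ENNReal.mul_rpow_of_nonneg _ _ hq.le,
    mul_mul_mul_comm, hinv] at key2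
  exact (ENNReal.mul_le_mul_iff_right (ENNReal.inv_ne_zero.2 (ENNReal.mul_ne_top hMp hNq))
    (ENNReal.inv_ne_top.2 (mul_ne_zero hMp0 hNq0))).1 key2

theorem holds_real : Holds (volume : Measure ℝ) := by
  intro p q hp hq hpq f g h hf hg hh H
  have rpow_iSup {r : ℝ} (hr : 0 < r) (u : ℕ → ℝ≥0∞) : (⨆ k, u k) ^ r = ⨆ k, u k ^ r :=
    (ENNReal.orderIsoRpow r hr).map_iSup u
  have bdd (u : ℝ → ℝ≥0∞) (k : ℕ) : ⨆ x, min (u x) k ≠ ∞ :=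
    ((iSup_le fun x => min_le_right _ _).trans_lt (ENNReal.natCast_lt_top k)).ne
  rw [lintegral_eq_iSup_lintegral_min volume hf, lintegral_eq_iSup_lintegral_min volume hg,
    rpow_iSup hp, rpow_iSup hq, ENNReal.iSup_mul]
  refine iSup_le fun k => ?_
  rw [ENNReal.mul_iSup]
  refine iSup_le fun l => ?_
  refine real_of_iSup_ne_top hp hq hpq (hf.min measurable_const) (hg.min measurable_const) hh
    (bdd f k) (bdd g l) fun x y => le_trans ?_ (H x y)
  gcongr <;> exact min_le_left _ _

section

variable {E F : Type*} [AddCommGroup E] [Module ℝ E] [MeasurableSpace E]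
  [AddCommGroup F] [Module ℝ F] [MeasurableSpace F] {μ : Measure E} {ν : Measure F}

theorem Holds.prod [SFinite ν] (hμ : Holds μ) (hν : Holds ν) : Holds (μ.prod ν) := by
  intro p q hp hq hpq f g h hf hg hh H
  rw [lintegral_prod _ hf.aemeasurable, lintegral_prod _ hg.aemeasurable,
    lintegral_prod _ hh.aemeasurable]
  refine hμ hp hq hpq hf.lintegral_prod_right' hg.lintegral_prod_right' hh.lintegral_prod_right'
    fun x y => ?_
  exact hν hp hq hpq (hf.comp measurable_prodMk_left) (hg.comp measurable_prodMk_left)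
    (hh.comp measurable_prodMk_left) fun a b => H (x, a) (y, b)

theorem Holds.of_measurePreserving (hμ : Holds μ) {e : E → F} (he : MeasurePreserving e μ ν)
    (hlin : IsLinearMap ℝ e) : Holds ν := by
  intro p q hp hq hpq f g h hf hg hh H
  rw [← he.lintegral_comp hf, ← he.lintegral_comp hg, ← he.lintegral_comp hh]
  refine hμ hp hq hpq (hf.comp he.measurable) (hg.comp he.measurable) (hh.comp he.measurable)
    fun x y => ?_
  simpa [hlin.map_add, hlin.map_smul] using H (e x) (e y)

end

theorem holds_pi (n : ℕ) : Holds (volume : Measure (Fin n → ℝ)) := by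
  induction n with
  | zero =>
    intro p q hp hq hpq f g h hf hg hh H
    rw [Measure.volume_pi_eq_dirac 0, lintegral_dirac' _ hf, lintegral_dirac' _ hg,
      lintegral_dirac' _ hh]
    simpa using H 0 0
  | succ n ih =>
    refine (holds_real.prod ih).of_measurePreserving
      (volume_preserving_piFinSuccAbove (fun _ => ℝ) 0).symm ⟨fun x y => ?_, fun c x => ?_⟩
    · ext i
      refine Fin.cases ?_ (fun j => ?_) i <;> simp [MeasurableEquiv.piFinSuccAbove]
    · ext i
      refine Fin.cases ?_ (fun j => ?_) i <;> simp [MeasurableEquiv.piFinSuccAbove]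

theorem holds_euclideanSpace (n : ℕ) : Holds (volume : Measure (EuclideanSpace ℝ (Fin n))) :=
  (holds_pi n).of_measurePreserving (PiLp.volume_preserving_toLp (Fin n))
    ⟨fun _ _ => rfl, fun _ _ => rfl⟩

/-- The multiplicative form of the Brunn–Minkowski inequality. -/
theorem Holds.measure_rpow_mul_le {E : Type*} [AddCommGroup E] [Module ℝ E] [MeasurableSpace E]
    {μ : Measure E} (hμ : Holds μ) {p q : ℝ} (hp : 0 < p) (hq : 0 < q) (hpq : p + q = 1)
    {A B C : Set E} (hA : MeasurableSet A) (hB : MeasurableSet B) (hC : MeasurableSet C)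
    (hABC : p • A + q • B ⊆ C) : μ A ^ p * μ B ^ q ≤ μ C := by
  have key := hμ hp hq hpq (f := A.indicator 1) (g := B.indicator 1) (h := C.indicator 1)
    (measurable_one.indicator hA) (measurable_one.indicator hB) (measurable_one.indicator hC)
    fun x y => by
      by_cases hx : x ∈ A
      · by_cases hy : y ∈ B
        · have : p • x + q • y ∈ C :=
            hABC (Set.add_mem_add (Set.smul_mem_smul_set hx) (Set.smul_mem_smul_set hy))
          simp [hx, hy, this]
        · simp [hy, hq]
      · simp [hx, hp]
  simpa [lintegral_indicator_one, hA, hB, hC] using key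

end PrekopaLeindler

/-- Brunn–Minkowski inequality: for nonempty compact sets `A, B ⊆ ℝ^n` (with `n ≥ 1`),
`μ(A + B)^{1/n} ≥ μ(A)^{1/n} + μ(B)^{1/n}`, where `A + B` is the Minkowski sum and `μ`
the `n`-dimensional Lebesgue measure. -/
theorem brunn_minkowski (n : ℕ) (hn : 0 < n)
    (A B : Set (EuclideanSpace ℝ (Fin n)))
    (hA : A.Nonempty) (hB : B.Nonempty) (hAc : IsCompact A) (hBc : IsCompact B) :
    volume A ^ ((1 : ℝ) / n) + volume B ^ ((1 : ℝ) / n) ≤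
      volume (A + B) ^ ((1 : ℝ) / n) := by
  have hn' : (0 : ℝ) < 1 / n := by positivity
  rcases eq_or_ne (volume A) 0 with hA0 | hA0
  · obtain ⟨a, ha⟩ := hA
    rw [hA0, ENNReal.zero_rpow_of_pos hn', zero_add, ← measure_vadd volume a B]
    gcongr
    rintro _ ⟨b, hb, rfl⟩
    exact Set.add_mem_add ha hb
  rcases eq_or_ne (volume B) 0 with hB0 | hB0
  · obtain ⟨b, hb⟩ := hB
    rw [hB0, ENNReal.zero_rpow_of_pos hn', add_zero, ← measure_vadd volume b A, add_comm A B]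
    gcongr
    rintro _ ⟨a, ha, rfl⟩
    exact Set.add_mem_add hb ha
  have root {S : Set (EuclideanSpace ℝ (Fin n))} (hS : IsCompact S) (hS0 : volume S ≠ 0) :
      ∃ s : ℝ, 0 < s ∧ volume S ^ ((1 : ℝ) / n) = ENNReal.ofReal s ∧
        volume (s⁻¹ • S) = 1 := by
    have hfin : volume S ^ ((1 : ℝ) / n) ≠ ∞ :=
      ENNReal.rpow_ne_top_of_nonneg hn'.le hS.measure_lt_top.ne
    have hpos : 0 < (volume S ^ ((1 : ℝ) / n)).toReal :=
      ENNReal.toReal_pos (ENNReal.rpow_pos (pos_iff_ne_zero.2 hS0) hS.measure_lt_top.ne).ne' hfin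
    have heq : volume S = ENNReal.ofReal (volume S ^ ((1 : ℝ) / n)).toReal ^ n := by
      rw [ENNReal.ofReal_toReal hfin, ← ENNReal.rpow_natCast, ← ENNReal.rpow_mul,
        one_div_mul_cancel (by positivity), ENNReal.rpow_one]
    refine ⟨_, hpos, (ENNReal.ofReal_toReal hfin).symm, ?_⟩
    generalize (volume S ^ ((1 : ℝ) / n)).toReal = s at hpos heq
    rw [Measure.addHaar_smul, finrank_euclideanSpace_fin, heq, ← ENNReal.ofReal_pow hpos.le,
      ← ENNReal.ofReal_mul (abs_nonneg _), abs_of_pos (by positivity), ← mul_pow,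
      inv_mul_cancel₀ hpos.ne', one_pow, ENNReal.ofReal_one]
  obtain ⟨s, hs, hsA, hA1⟩ := root hAc hA0
  obtain ⟨t, ht, htB, hB1⟩ := root hBc hB0
  have hst : 0 < s + t := add_pos hs ht
  have key := (PrekopaLeindler.holds_euclideanSpace n).measure_rpow_mul_le
    (p := s / (s + t)) (q := t / (s + t)) (by positivity) (by positivity) (by field_simp)
    (hAc.smul s⁻¹).measurableSet (hBc.smul t⁻¹).measurableSet
    ((hAc.add hBc).smul (s + t)⁻¹).measurableSet
    (by
      rw [smul_smul, smul_smul, smul_add, div_mul_eq_mul_div, div_mul_eq_mul_div,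
        mul_inv_cancel₀ hs.ne', mul_inv_cancel₀ ht.ne', one_div])
  rw [hA1, hB1, ENNReal.one_rpow, ENNReal.one_rpow, one_mul, Measure.addHaar_smul,
    finrank_euclideanSpace_fin, abs_of_pos (by positivity), inv_pow,
    ENNReal.ofReal_inv_of_pos (by positivity), mul_comm, ← div_eq_mul_inv,
    ENNReal.le_div_iff_mul_le (.inl (by simp; positivity)) (.inl ENNReal.ofReal_ne_top),
    one_mul, ENNReal.ofReal_pow hst.le] at key
  rw [hsA, htB, ← ENNReal.ofReal_add hs.le ht.le, one_div, ENNReal.le_rpow_inv_iff (by positivity),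
    ENNReal.rpow_natCast]
  exact key
end

section
/- Isoperimetric-type statement: among nonempty compact sets A ⊂ ℝ^n of fixed positive volume, the Euclidean ball minimizes μ(A + B_ε) for every ε > 0; i.e., if K is a ball with μ(K) = μ(A), then μ(K + B_ε) ≤ μ(A + B_ε). -/
open MeasureTheory
open scoped ENNReal Pointwise

theorem Real.volume_add_le_of_isCompact {K L : Set ℝ} (hK : IsCompact K) (hL : IsCompact L)
    (hKn : K.Nonempty) (hLn : L.Nonempty) : volume K + volume L ≤ volume (K + L) := by
  obtain ⟨p, hpK, hp⟩ := hK.exists_isGreatest hKn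
  obtain ⟨q, hqL, hq⟩ := hL.exists_isLeast hLn
  have hinter : (q +ᵥ K) ∩ (p +ᵥ L) ⊆ {p + q} := by
    rintro _ ⟨⟨k, hk, rfl⟩, ⟨l, hl, h⟩⟩
    have h₁ := hp hk
    have h₂ := hq hl
    simp only [vadd_eq_add, Set.mem_singleton_iff] at h ⊢
    linarith
  have hdisj : AEDisjoint volume (q +ᵥ K) (p +ᵥ L) :=
    measure_mono_null hinter Real.volume_singleton
  calc volume K + volume L = volume (q +ᵥ K) + volume (p +ᵥ L) := by
        rw [measure_vadd, measure_vadd]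
    _ = volume ((q +ᵥ K) ∪ (p +ᵥ L)) :=
        (measure_union₀ (hL.vadd p).measurableSet.nullMeasurableSet hdisj).symm
    _ ≤ volume (K + L) := by
        refine measure_mono (Set.union_subset ?_ ?_)
        · rintro _ ⟨k, hk, rfl⟩
          exact ⟨k, hk, q, hqL, add_comm _ _⟩
        · rintro _ ⟨l, hl, rfl⟩
          exact ⟨p, hpK, l, hl, rfl⟩

/-- The Brunn–Minkowski inequality on the real line. -/
theorem Real.volume_add_le {A B : Set ℝ} (hA : MeasurableSet A) (hB : MeasurableSet B)
    (hAn : A.Nonempty) (hBn : B.Nonempty) : volume A + volume B ≤ volume (A + B) := by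
  obtain ⟨p, hp⟩ := hAn
  obtain ⟨q, hq⟩ := hBn
  rw [hA.measure_eq_iSup_isCompact, hB.measure_eq_iSup_isCompact]
  simp only [iSup_and']
  refine ENNReal.biSup_add_biSup_le' (p := fun K => K ⊆ A ∧ IsCompact K)
    (q := fun L => L ⊆ B ∧ IsCompact L) ⟨∅, by simp⟩ ⟨∅, by simp⟩ fun K hK L hL => ?_
  calc volume K + volume L ≤ volume (insert p K) + volume (insert q L) := by
        gcongr <;> exact Set.subset_insert _ _
    _ ≤ volume (insert p K + insert q L) :=
        Real.volume_add_le_of_isCompact (hK.2.insert p) (hL.2.insert q)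
          (Set.insert_nonempty _ _) (Set.insert_nonempty _ _)
    _ ≤ volume (A + B) := by
        gcongr
        · exact Set.insert_subset hp hK.1
        · exact Set.insert_subset hq hL.1

theorem ENNReal.geom_mean_le_arith_mean2_weighted {a b : ℝ} (ha : 0 < a) (hb : 0 < b)
    (hab : a + b = 1) (x y : ℝ≥0∞) :
    x ^ a * y ^ b ≤ ENNReal.ofReal a * x + ENNReal.ofReal b * y := by
  induction x with
  | top => simp [ENNReal.mul_top, ha]
  | coe x =>
    induction y with
    | top => simp [ENNReal.mul_top, hb]
    | coe y =>
      rw [← ENNReal.coe_rpow_of_nonneg _ ha.le, ← ENNReal.coe_rpow_of_nonneg _ hb.le,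
        ENNReal.ofReal, ENNReal.ofReal]
      norm_cast
      have := NNReal.geom_mean_le_arith_mean2_weighted a.toNNReal b.toNNReal x y
        (by rw [← Real.toNNReal_add ha.le hb.le, hab, Real.toNNReal_one])
      simpa [ha.le, hb.le] using this

/-- `h` dominates the weighted geometric mean of `f` and `g` along weighted means of points. -/
def GeomMeanDominated {E : Type*} [Add E] [SMul ℝ E] (a b : ℝ) (f g h : E → ℝ≥0∞) : Prop :=
  ∀ x y, f x ^ a * g y ^ b ≤ h (a • x + b • y)

theorem ENNReal.lintegral_eq_lintegral_meas_lt_of_le_one {α : Type*} [MeasurableSpace α]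
    (μ : Measure α) {f : α → ℝ≥0∞} (hf : Measurable f) (hf1 : ∀ x, f x ≤ 1) :
    ∫⁻ x, f x ∂μ = ∫⁻ t in Set.Ioo (0 : ℝ) 1, μ {x | ENNReal.ofReal t < f x} := by
  have hfin : ∀ x, f x ≠ ∞ := fun x => ((hf1 x).trans_lt ENNReal.one_lt_top).ne
  have h := lintegral_eq_lintegral_meas_lt μ (f := fun x => (f x).toReal)
    (.of_forall fun x => ENNReal.toReal_nonneg) hf.ennreal_toReal.aemeasurable
  simp only [ENNReal.ofReal_toReal (hfin _)] at h
  rw [h]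
  have hsplit : Set.Ioi (0 : ℝ) = Set.Ioo 0 1 ∪ Set.Ici 1 := by
    rw [Set.Ioo_union_Ici_eq_Ioi one_pos]
  rw [hsplit, lintegral_union measurableSet_Ici
    (Set.disjoint_left.2 fun x hx hx' => not_le.2 hx.2 hx')]
  have hzero : ∫⁻ t in Set.Ici (1 : ℝ), μ {x | t < (f x).toReal} = 0 := by
    rw [setLIntegral_congr_fun (g := fun _ => 0) measurableSet_Ici, lintegral_zero]
    intro t ht
    have : {x | t < (f x).toReal} = ∅ := by
      ext x
      have := ENNReal.toReal_mono ENNReal.one_ne_top (hf1 x)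
      simp only [ENNReal.toReal_one, Set.mem_Ici] at this ht
      simp; linarith
    simp [this]
  rw [hzero, add_zero]
  refine setLIntegral_congr_fun measurableSet_Ioo fun t ht => ?_
  simp only [ENNReal.ofReal_lt_iff_lt_toReal ht.1.le (hfin _)]


theorem GeomMeanDominated.lintegral_real_of_iSup_eq_one {a b : ℝ} (ha : 0 < a) (hb : 0 < b)
    (hab : a + b = 1) {f g h : ℝ → ℝ≥0∞} (hf : Measurable f) (hg : Measurable g)
    (hh : Measurable h) (hf1 : ⨆ x, f x = 1) (hg1 : ⨆ x, g x = 1)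
    (H : GeomMeanDominated a b f g h) :
    (∫⁻ x, f x) ^ a * (∫⁻ x, g x) ^ b ≤ ∫⁻ x, h x := by
  have hfle : ∀ x, f x ≤ 1 := fun x => hf1 ▸ le_iSup f x
  have hgle : ∀ x, g x ≤ 1 := fun x => hg1 ▸ le_iSup g x
  refine (ENNReal.geom_mean_le_arith_mean2_weighted ha hb hab _ _).trans ?_
  refine le_trans ?_ (lintegral_mono fun x => min_le_left (h x) 1)
  rw [ENNReal.lintegral_eq_lintegral_meas_lt_of_le_one _ hf hfle,
    ENNReal.lintegral_eq_lintegral_meas_lt_of_le_one _ hg hgle,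
    ENNReal.lintegral_eq_lintegral_meas_lt_of_le_one _ (hh.min measurable_const)
      fun x => min_le_right _ _,
    ← lintegral_const_mul' _ _ ENNReal.ofReal_ne_top,
    ← lintegral_const_mul' _ _ ENNReal.ofReal_ne_top]
  refine (le_lintegral_add _ _).trans (setLIntegral_mono' measurableSet_Ioo fun t ht => ?_)
  have ht1 : ENNReal.ofReal t < 1 := by simpa using ht.2
  have hfn : {x | ENNReal.ofReal t < f x}.Nonempty := by
    rw [← hf1] at ht1
    exact lt_iSup_iff.1 ht1
  have hgn : {x | ENNReal.ofReal t < g x}.Nonempty := by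
    rw [← hg1] at ht1
    exact lt_iSup_iff.1 ht1
  have hvol : ∀ {c : ℝ} (_ : 0 < c) (S : Set ℝ), ENNReal.ofReal c * volume S = volume (c • S) :=
    fun hc S => by simp [Measure.addHaar_smul, abs_of_pos hc]
  rw [hvol ha, hvol hb]
  refine (Real.volume_add_le ((measurableSet_lt measurable_const hf).const_smul₀ a)
    ((measurableSet_lt measurable_const hg).const_smul₀ b) hfn.smul_set hgn.smul_set).trans
    (measure_mono ?_)
  rintro _ ⟨_, ⟨x, hx, rfl⟩, _, ⟨y, hy, rfl⟩, rfl⟩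
  refine lt_min (lt_of_lt_of_le ?_ (H x y)) ht1
  calc ENNReal.ofReal t = ENNReal.ofReal t ^ a * ENNReal.ofReal t ^ b := by
        rw [← ENNReal.rpow_add_of_nonneg _ _ ha.le hb.le, hab, ENNReal.rpow_one]
    _ < f x ^ a * g y ^ b :=
        ENNReal.mul_lt_mul (ENNReal.rpow_lt_rpow hx ha) (ENNReal.rpow_lt_rpow hy hb)

theorem GeomMeanDominated.lintegral_real_of_iSup_ne_top {a b : ℝ} (ha : 0 < a) (hb : 0 < b)
    (hab : a + b = 1) {f g h : ℝ → ℝ≥0∞} (hf : Measurable f) (hg : Measurable g)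
    (hh : Measurable h) (hftop : ⨆ x, f x ≠ ∞) (hgtop : ⨆ x, g x ≠ ∞)
    (H : GeomMeanDominated a b f g h) :
    (∫⁻ x, f x) ^ a * (∫⁻ x, g x) ^ b ≤ ∫⁻ x, h x := by
  set M := ⨆ x, f x with hM
  set N := ⨆ x, g x with hN
  rcases eq_or_ne M 0 with hM0 | hM0
  · have : ∀ x, f x = 0 := fun x => le_antisymm (hM0 ▸ le_iSup f x) zero_le
    simp [this, ha]
  rcases eq_or_ne N 0 with hN0 | hN0
  · have : ∀ x, g x = 0 := fun x => le_antisymm (hN0 ▸ le_iSup g x) zero_le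
    simp [this, hb]
  set c := M ^ a * N ^ b with hc
  have hc0 : c ≠ 0 := mul_ne_zero (by simp [hM0, hftop]) (by simp [hN0, hgtop])
  have hctop : c ≠ ∞ := ENNReal.mul_ne_top (ENNReal.rpow_ne_top_of_nonneg ha.le hftop)
    (ENNReal.rpow_ne_top_of_nonneg hb.le hgtop)
  have hscale : ∀ u v : ℝ≥0∞, (M⁻¹ * u) ^ a * (N⁻¹ * v) ^ b = c⁻¹ * (u ^ a * v ^ b) := by
    intro u v
    rw [ENNReal.mul_rpow_of_nonneg _ _ ha.le, ENNReal.mul_rpow_of_nonneg _ _ hb.le, hc,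
      ENNReal.mul_inv (by simp [hM0, hftop]) (by simp [hM0, hftop]),
      ENNReal.inv_rpow, ENNReal.inv_rpow]
    ring
  have key := GeomMeanDominated.lintegral_real_of_iSup_eq_one ha hb hab
    (hf.const_mul M⁻¹) (hg.const_mul N⁻¹) (hh.const_mul c⁻¹)
    (by rw [← ENNReal.mul_iSup, ← hM, ENNReal.inv_mul_cancel hM0 hftop])
    (by rw [← ENNReal.mul_iSup, ← hN, ENNReal.inv_mul_cancel hN0 hgtop])
    (fun x y => by rw [hscale]; gcongr; exact H x y)
  rw [lintegral_const_mul _ hf, lintegral_const_mul _ hg, lintegral_const_mul _ hh, hscale] at key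
  exact (ENNReal.mul_le_mul_iff_right (ENNReal.inv_ne_zero.2 hctop) (ENNReal.inv_ne_top.2 hc0)).1 key

/-- The Prékopa–Leindler inequality on the real line. -/
theorem GeomMeanDominated.lintegral_real {a b : ℝ} (ha : 0 < a) (hb : 0 < b)
    (hab : a + b = 1) {f g h : ℝ → ℝ≥0∞} (hf : Measurable f) (hg : Measurable g)
    (hh : Measurable h) (H : GeomMeanDominated a b f g h) :
    (∫⁻ x, f x) ^ a * (∫⁻ x, g x) ^ b ≤ ∫⁻ x, h x := by
  rcases eq_or_ne (∫⁻ x, f x) 0 with hf0 | hf0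
  · simp [hf0, ha]
  rcases eq_or_ne (∫⁻ x, g x) 0 with hg0 | hg0
  · simp [hg0, hb]
  have htrunc : ∀ {u : ℝ → ℝ≥0∞}, Measurable u →
      Filter.Tendsto (fun k : ℕ => ∫⁻ x, min (u x) k) Filter.atTop (nhds (∫⁻ x, u x)) := by
    intro u hu
    refine lintegral_tendsto_of_tendsto_of_monotone
      (fun k => (hu.min measurable_const).aemeasurable)
      (.of_forall fun x i j hij => min_le_min_left _ (by exact_mod_cast hij))
      (.of_forall fun x => ?_)
    simpa using (tendsto_const_nhds (x := u x)).min ENNReal.tendsto_nat_nhds_top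
  have hne : ∀ {u : ℝ → ℝ≥0∞} {k : ℕ}, ⨆ x, min (u x) k ≠ ∞ := fun {u k} =>
    ((iSup_le fun x => min_le_right (u x) k).trans_lt (ENNReal.natCast_lt_top k)).ne
  refine le_of_tendsto' (ENNReal.Tendsto.mul
    ((ENNReal.continuous_rpow_const.tendsto _).comp (htrunc hf)) (Or.inl ?_)
    ((ENNReal.continuous_rpow_const.tendsto _).comp (htrunc hg)) (Or.inl ?_)) fun k =>
    GeomMeanDominated.lintegral_real_of_iSup_ne_top ha hb hab (hf.min measurable_const)
      (hg.min measurable_const) hh hne hne fun x y => le_trans ?_ (H x y)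
  · simp [hf0, ha, ha.not_gt]
  · simp [hg0, hb, hb.not_gt]
  · gcongr <;> exact min_le_left _ _

/-- The Prékopa–Leindler inequality. -/
theorem GeomMeanDominated.lintegral_pi {a b : ℝ} (ha : 0 < a) (hb : 0 < b)
    (hab : a + b = 1) {n : ℕ} {f g h : (Fin n → ℝ) → ℝ≥0∞} (hf : Measurable f)
    (hg : Measurable g) (hh : Measurable h) (H : GeomMeanDominated a b f g h) :
    (∫⁻ x, f x) ^ a * (∫⁻ x, g x) ^ b ≤ ∫⁻ x, h x := by
  induction n with
  | zero =>
    simp only [Measure.volume_pi_eq_dirac (0 : Fin 0 → ℝ), lintegral_dirac]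
    simpa using H 0 0
  | succ n ih =>
    let e := (MeasurableEquiv.piFinSuccAbove (fun _ : Fin (n + 1) => ℝ) 0).symm
    have he : MeasurePreserving e := (volume_preserving_piFinSuccAbove (fun _ => ℝ) 0).symm
    have hint : ∀ {u : (Fin (n + 1) → ℝ) → ℝ≥0∞}, Measurable u →
        ∫⁻ x, u x = ∫⁻ s, ∫⁻ v, u (e (s, v)) := by
      intro u hu
      rw [← he.lintegral_comp hu, Measure.volume_eq_prod,
        lintegral_prod (fun p => u (e p)) (hu.comp e.measurable).aemeasurable]
    have hmeas : ∀ {u : (Fin (n + 1) → ℝ) → ℝ≥0∞}, Measurable u →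
        Measurable fun p : ℝ × (Fin n → ℝ) => u (e p) := fun hu => hu.comp e.measurable
    have hlin : ∀ (s t : ℝ) (v w : Fin n → ℝ),
        a • e (s, v) + b • e (t, w) = e (a • s + b • t, a • v + b • w) := by
      intro s t v w
      ext i
      refine Fin.cases ?_ (fun i => ?_) i <;> simp [e, MeasurableEquiv.piFinSuccAbove]
    rw [hint hf, hint hg, hint hh]
    refine GeomMeanDominated.lintegral_real ha hb hab (hmeas hf).lintegral_prod_right'
      (hmeas hg).lintegral_prod_right' (hmeas hh).lintegral_prod_right' fun s t => ?_
    refine ih ((hmeas hf).comp measurable_prodMk_left) ((hmeas hg).comp measurable_prodMk_left)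
      ((hmeas hh).comp measurable_prodMk_left) fun v w => ?_
    simpa only [Function.comp_apply, hlin] using H (e (s, v)) (e (t, w))

/-- The multiplicative form of the Brunn–Minkowski inequality. -/
theorem EuclideanSpace.volume_rpow_mul_volume_rpow_le {n : ℕ} {a b : ℝ} (ha : 0 < a)
    (hb : 0 < b) (hab : a + b = 1) {A B C : Set (EuclideanSpace ℝ (Fin n))}
    (hA : MeasurableSet A) (hB : MeasurableSet B) (hC : MeasurableSet C)
    (hABC : a • A + b • B ⊆ C) : volume A ^ a * volume B ^ b ≤ volume C := by
  have hvol : ∀ {S : Set (EuclideanSpace ℝ (Fin n))}, MeasurableSet S →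
      volume S = ∫⁻ x : Fin n → ℝ, S.indicator 1 (WithLp.toLp 2 x) := by
    intro S hS
    rw [(PiLp.volume_preserving_toLp (Fin n)).lintegral_comp (measurable_one.indicator hS),
      lintegral_indicator_one hS]
  have hmeas : ∀ {S : Set (EuclideanSpace ℝ (Fin n))}, MeasurableSet S →
      Measurable fun x : Fin n → ℝ => S.indicator (1 : EuclideanSpace ℝ (Fin n) → ℝ≥0∞) (WithLp.toLp 2 x) :=
    fun hS => (measurable_one.indicator hS).comp
      (PiLp.volume_preserving_toLp (Fin n)).measurable
  rw [hvol hA, hvol hB, hvol hC]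
  refine GeomMeanDominated.lintegral_pi ha hb hab (hmeas hA) (hmeas hB) (hmeas hC) fun x y => ?_
  by_cases hx : WithLp.toLp 2 x ∈ A
  · by_cases hy : WithLp.toLp 2 y ∈ B
    · have : a • WithLp.toLp 2 x + b • WithLp.toLp 2 y ∈ C :=
        hABC (Set.add_mem_add (Set.smul_mem_smul_set hx) (Set.smul_mem_smul_set hy))
      simp [hx, hy, this]
    · simp [hy, hb]
  · simp [hx, ha]

/-- Isoperimetric-type statement: among nonempty compact sets of fixed positive volume,
the Euclidean ball minimizes the volume of the ε-enlargement: if `K` is a closed ball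
with `μ(K) = μ(A)`, then `μ(K + B_ε) ≤ μ(A + B_ε)` for every `ε > 0`. -/
theorem ball_minimizes_eps_enlargement (n : ℕ) (hn : 0 < n)
    (A : Set (EuclideanSpace ℝ (Fin n)))
    (hA : A.Nonempty) (hAc : IsCompact A) (hAvol : 0 < volume A)
    (x : EuclideanSpace ℝ (Fin n)) (R : ℝ) (hR : 0 ≤ R)
    (hK : volume (Metric.closedBall x R) = volume A)
    (ε : ℝ) (hε : 0 < ε) :
    volume (Metric.closedBall x R + Metric.closedBall (0 : EuclideanSpace ℝ (Fin n)) ε) ≤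
      volume (A + Metric.closedBall (0 : EuclideanSpace ℝ (Fin n)) ε) := by
  have : NeZero n := ⟨hn.ne'⟩
  have hRpos : 0 < R := by
    refine hR.lt_of_ne fun h => ?_
    have : volume (Metric.closedBall x R) = 0 := by simp [← h]
    exact hAvol.ne' (hK ▸ this)
  have hS : 0 < R + ε := by positivity
  set a := R / (R + ε) with ha_def
  set b := ε / (R + ε) with hb_def
  have ha : 0 < a := by positivity
  have hb : 0 < b := by positivity
  have hab : a + b = 1 := by rw [ha_def, hb_def]; field_simp
  have haR : a⁻¹ * R = R + ε := by rw [ha_def]; field_simp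
  have hbε : b⁻¹ * ε = R + ε := by rw [hb_def]; field_simp
  have hvolA : volume (a⁻¹ • A) =
      volume (Metric.closedBall (0 : EuclideanSpace ℝ (Fin n)) (R + ε)) := by
    rw [Measure.addHaar_smul, ← hK, ← Measure.addHaar_smul, smul_closedBall _ _ hR,
      Real.norm_of_nonneg (inv_pos.2 ha).le, haR, Measure.addHaar_closedBall_center]
  have hvolB : volume (b⁻¹ • Metric.closedBall (0 : EuclideanSpace ℝ (Fin n)) ε) =
      volume (Metric.closedBall (0 : EuclideanSpace ℝ (Fin n)) (R + ε)) := by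
    rw [smul_closedBall _ _ hε.le, Real.norm_of_nonneg (inv_pos.2 hb).le, hbε, smul_zero]
  have hBc := isCompact_closedBall (0 : EuclideanSpace ℝ (Fin n)) ε
  have key := EuclideanSpace.volume_rpow_mul_volume_rpow_le ha hb hab
    (hAc.smul a⁻¹).measurableSet (hBc.smul b⁻¹).measurableSet (hAc.add hBc).measurableSet
    (by rw [smul_inv_smul₀ ha.ne', smul_inv_smul₀ hb.ne'])
  rw [hvolA, hvolB, ← ENNReal.rpow_add_of_nonneg _ _ ha.le hb.le, hab, ENNReal.rpow_one] at key
  rwa [closedBall_add_closedBall hR hε.le, Measure.addHaar_closedBall_center]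
end
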